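/- arXiv:1207.1587 — 7 statements merged into one kernel-verified Lean document; each statement's English description precedes it below -/
import Mathlib

section
/- The function f : ℝ → ℝ defined by f x = -1 for x < 0, f 0 = 0, and f x = 1 for x > 0 is hyperplane minimal but is not quasicontinuous (it fails to be quasicontinuous at 0). -/
open Filter Set Topology

section Defs

variable {X Y : Type*}

/-- `F` is upper semicontinuous at `x` (as a set-valued map). -/
def UscoAt [TopologicalSpace X] [TopologicalSpace Y] (F : X → Set Y) (x : X) : Prop :=
  ∀ V : Set Y, IsOpen V → F x ⊆ V → ∃ U ∈ 𝓝 x, ∀ u ∈ U, F u ⊆ V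

/-- `F` is usco: upper semicontinuous everywhere with nonempty compact values. -/
def IsUsco [TopologicalSpace X] [TopologicalSpace Y] (F : X → Set Y) : Prop :=
  (∀ x, (F x).Nonempty) ∧ (∀ x, IsCompact (F x)) ∧ (∀ x, UscoAt F x)

/-- `F` is a minimal usco map. -/
def IsMinimalUsco [TopologicalSpace X] [TopologicalSpace Y] (F : X → Set Y) : Prop :=
  IsUsco F ∧ ∀ G : X → Set Y, IsUsco G → (∀ x, G x ⊆ F x) → G = F

/-- `F` is cusco: usco with convex values. -/
def IsCusco [TopologicalSpace X] [TopologicalSpace Y] [AddCommGroup Y] [Module ℝ Y]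
    (F : X → Set Y) : Prop :=
  IsUsco F ∧ ∀ x, Convex ℝ (F x)

/-- `F` is a minimal cusco map. -/
def IsMinimalCusco [TopologicalSpace X] [TopologicalSpace Y] [AddCommGroup Y] [Module ℝ Y]
    (F : X → Set Y) : Prop :=
  IsCusco F ∧ ∀ G : X → Set Y, IsCusco G → (∀ x, G x ⊆ F x) → G = F

/-- `f` is quasicontinuous at `x`. -/
def QuasicontinuousAt [TopologicalSpace X] [TopologicalSpace Y] (f : X → Y) (x : X) : Prop :=
  ∀ V : Set Y, IsOpen V → f x ∈ V → ∀ U : Set X, IsOpen U → x ∈ U →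
    ∃ G : Set X, IsOpen G ∧ G.Nonempty ∧ G ⊆ U ∧ f '' G ⊆ V

/-- `f` is quasicontinuous. -/
def Quasicontinuous [TopologicalSpace X] [TopologicalSpace Y] (f : X → Y) : Prop :=
  ∀ x, QuasicontinuousAt f x

/-- `f` is subcontinuous at `x`: the image of every ultrafilter converging to `x` converges. -/
def SubcontinuousAt [TopologicalSpace X] [TopologicalSpace Y] (f : X → Y) (x : X) : Prop :=
  ∀ 𝔘 : Ultrafilter X, (𝔘 : Filter X) ≤ 𝓝 x → ∃ y : Y, Tendsto f 𝔘 (𝓝 y)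

/-- `f` is subcontinuous. -/
def Subcontinuous [TopologicalSpace X] [TopologicalSpace Y] (f : X → Y) : Prop :=
  ∀ x, SubcontinuousAt f x

/-- The closure-of-graph map of `f` : the value at `x` is the vertical section at `x`
of the closure of the graph of `f`. -/
def graphCl [TopologicalSpace X] [TopologicalSpace Y] (f : X → Y) (x : X) : Set Y :=
  {y | (x, y) ∈ closure {p : X × Y | p.2 = f p.1}}

/-- `f` is hyperplane minimal. -/
def HyperplaneMinimal [TopologicalSpace X] [TopologicalSpace Y] [AddCommGroup Y] [Module ℝ Y]
    (f : X → Y) : Prop :=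
  ∀ (l : Y →L[ℝ] ℝ) (lam : ℝ) (U : Set X), IsOpen U → U.Nonempty →
    (f '' U ∩ {y : Y | lam < l y}).Nonempty →
    ∃ V : Set X, IsOpen V ∧ V.Nonempty ∧ V ⊆ U ∧ f '' V ⊆ {y : Y | lam < l y}

/-- A densely defined `f : A → Y` is subcontinuous at `x ∈ X`: the image of every ultrafilter
on `A` converging to `x` in `X` converges in `Y`. -/
def DSubcontinuousAt [TopologicalSpace X] [TopologicalSpace Y] (A : Set X) (f : A → Y)
    (x : X) : Prop :=
  ∀ 𝔘 : Ultrafilter A, Tendsto (Subtype.val : A → X) 𝔘 (𝓝 x) → ∃ y : Y, Tendsto f 𝔘 (𝓝 y)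

/-- The closure-of-graph map of a densely defined function `f : A → Y`. -/
def dGraphCl [TopologicalSpace X] [TopologicalSpace Y] (A : Set X) (f : A → Y) (x : X) : Set Y :=
  {y | (x, y) ∈ closure {p : X × Y | ∃ a : A, p = ((a : X), f a)}}

/-- A densely defined `f : A → Y` is hyperplane minimal. -/
def DHyperplaneMinimal [TopologicalSpace X] [TopologicalSpace Y] [AddCommGroup Y] [Module ℝ Y]
    (A : Set X) (f : A → Y) : Prop :=
  ∀ (l : Y →L[ℝ] ℝ) (lam : ℝ) (U : Set X), IsOpen U →
    (f '' ((Subtype.val : A → X) ⁻¹' U) ∩ {y : Y | lam < l y}).Nonempty →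
    ∃ V : Set X, IsOpen V ∧ V.Nonempty ∧ V ⊆ U ∧
      f '' ((Subtype.val : A → X) ⁻¹' V) ⊆ {y : Y | lam < l y}

end Defs


theorem stmt3 (f : ℝ → ℝ) (hneg : ∀ x < (0 : ℝ), f x = -1) (h0 : f 0 = 0)
    (hpos : ∀ x > (0 : ℝ), f x = 1) :
    HyperplaneMinimal f ∧ ¬ Quasicontinuous f ∧ ¬ QuasicontinuousAt f 0 := by
  have not_quasi : ¬ QuasicontinuousAt f 0 := by
    intro h
    obtain ⟨G, hG, hne, -, hGV⟩ := h (Ioo (-1) 1) isOpen_Ioo (by simp [h0]) univ isOpen_univ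
      (mem_univ 0)
    obtain ⟨g, hg, hg0⟩ := (dense_compl_singleton (0 : ℝ)).inter_open_nonempty G hG hne
    have hfg := hGV (mem_image_of_mem f hg)
    rcases lt_or_gt_of_ne hg0 with hlt | hgt
    · simp [hneg g hlt] at hfg
    · simp [hpos g hgt] at hfg
  refine ⟨?_, fun h => not_quasi (h 0), not_quasi⟩
  rintro l lam U hU - ⟨_, ⟨x, hxU, rfl⟩, hx⟩
  have right (hx0 : 0 ≤ x) (hl : lam < l 1) :
      ∃ V : Set ℝ, IsOpen V ∧ V.Nonempty ∧ V ⊆ U ∧ f '' V ⊆ {y : ℝ | lam < l y} := by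
    refine ⟨U ∩ Ioi 0, hU.inter isOpen_Ioi, ?_, inter_subset_left, ?_⟩
    · exact mem_closure_iff.mp (by simpa using hx0) U hU hxU
    · rintro _ ⟨y, ⟨-, hy⟩, rfl⟩
      simpa [hpos y hy] using hl
  have left (hx0 : x ≤ 0) (hl : lam < l (-1)) :
      ∃ V : Set ℝ, IsOpen V ∧ V.Nonempty ∧ V ⊆ U ∧ f '' V ⊆ {y : ℝ | lam < l y} := by
    refine ⟨U ∩ Iio 0, hU.inter isOpen_Iio, ?_, inter_subset_left, ?_⟩
    · exact mem_closure_iff.mp (by simpa using hx0) U hU hxU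
    · rintro _ ⟨y, ⟨-, hy⟩, rfl⟩
      simpa [hneg y hy] using hl
  change lam < l (f x) at hx
  rcases lt_trichotomy x 0 with hlt | rfl | hgt
  · exact left hlt.le (by rwa [hneg x hlt] at hx)
  · rw [h0, map_zero] at hx
    rcases le_total 0 (l 1) with hl | hl
    · exact right le_rfl (hx.trans_le hl)
    · exact left le_rfl (by rw [map_neg]; linarith)
  · exact right hgt.le (by rwa [hpos x hgt] at hx)
end

section
/- Let X, Y be topological spaces, A a dense subset of X, and f : A → Y a function. Then f is subcontinuous at a point x ∈ X (every net in A converging to x has a subnet whose image under f converges in Y) if and only if for every open cover 𝓗 of Y there exist a finite subfamily 𝓕 of 𝓗 and a neighborhood U of x such that f '' (U ∩ A) ⊆ ⋃ 𝓕. -/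
open Filter Set Topology

variable {X Y : Type*} [TopologicalSpace X] [TopologicalSpace Y]

theorem exists_finset_cover_mem_of_forall_ultrafilter {α β : Type*} [TopologicalSpace β]
    {l : Filter α} {f : α → β}
    (hf : ∀ 𝔘 : Ultrafilter α, (𝔘 : Filter α) ≤ l → ∃ y, Tendsto f 𝔘 (𝓝 y))
    {𝓗 : Set (Set β)} (hopen : ∀ H ∈ 𝓗, IsOpen H) (hcover : ⋃₀ 𝓗 = univ) :
    ∃ 𝓕 : Finset (Set β), (𝓕 : Set (Set β)) ⊆ 𝓗 ∧ f ⁻¹' ⋃₀ (𝓕 : Set (Set β)) ∈ l := by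
  classical
  let g : Filter α :=
    Filter.comk
      (fun s => ∃ 𝓕 : Finset (Set β), (𝓕 : Set (Set β)) ⊆ 𝓗 ∧ s ⊆ f ⁻¹' ⋃₀ (𝓕 : Set (Set β)))
      ⟨∅, by simp, empty_subset _⟩
      (fun t ⟨𝓕, h𝓕, ht⟩ s hst => ⟨𝓕, h𝓕, hst.trans ht⟩)
      (fun s ⟨𝓕, h𝓕, hs⟩ t ⟨𝓖, h𝓖, ht⟩ => ⟨𝓕 ∪ 𝓖, by simp [h𝓕, h𝓖], by
        rw [Finset.coe_union, sUnion_union, preimage_union]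
        exact union_subset_union hs ht⟩)
  by_contra! h
  have hne : (l ⊓ g).NeBot := by
    rw [neBot_iff, Ne, ← _root_.disjoint_iff, Filter.disjoint_iff]
    rintro ⟨s, hs, t, ⟨𝓕, h𝓕, ht⟩, hst⟩
    exact h 𝓕 h𝓕 (mem_of_superset hs (hst.subset_compl_right.trans ht))
  obtain ⟨y, hy⟩ := hf (Ultrafilter.of (l ⊓ g)) ((Ultrafilter.of_le _).trans inf_le_left)
  obtain ⟨H, hH, hyH⟩ : y ∈ ⋃₀ 𝓗 := hcover ▸ mem_univ y
  refine Ultrafilter.compl_notMem_iff.mpr (hy ((hopen H hH).mem_nhds hyH)) ?_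
  exact (Ultrafilter.of_le (l ⊓ g)).trans inf_le_right ⟨{H}, by simpa using hH, by simp⟩

theorem Ultrafilter.exists_tendsto_of_forall_cover {α β : Type*} [TopologicalSpace β]
    {𝔘 : Ultrafilter α} {f : α → β}
    (h : ∀ 𝓗 : Set (Set β), (∀ H ∈ 𝓗, IsOpen H) → ⋃₀ 𝓗 = univ →
      ∃ 𝓕 : Finset (Set β), (𝓕 : Set (Set β)) ⊆ 𝓗 ∧ f ⁻¹' ⋃₀ (𝓕 : Set (Set β)) ∈ 𝔘) :
    ∃ y, Tendsto f 𝔘 (𝓝 y) := by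
  by_contra! hlim
  obtain ⟨𝓕, h𝓕, hmem⟩ := h {H | IsOpen H ∧ f ⁻¹' H ∉ 𝔘} (fun _ hH => hH.1) (by
    refine eq_univ_of_forall fun y => ?_
    have hy := hlim y
    simp only [(nhds_basis_opens y).tendsto_right_iff, not_forall] at hy
    obtain ⟨H, ⟨hyH, hH⟩, hnot⟩ := hy
    exact ⟨H, ⟨hH, hnot⟩, hyH⟩)
  rw [preimage_sUnion, Ultrafilter.finite_biUnion_mem_iff 𝓕.finite_toSet] at hmem
  obtain ⟨H, hH, hHmem⟩ := hmem
  exact (h𝓕 hH).2 hHmem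

theorem stmt6 (A : Set X) (hA : Dense A) (f : A → Y) (x : X) :
    DSubcontinuousAt A f x ↔
      ∀ 𝓗 : Set (Set Y), (∀ H ∈ 𝓗, IsOpen H) → ⋃₀ 𝓗 = univ →
        ∃ 𝓕 : Finset (Set Y), (𝓕 : Set (Set Y)) ⊆ 𝓗 ∧
          ∃ U ∈ 𝓝 x, f '' ((Subtype.val : A → X) ⁻¹' U) ⊆ ⋃₀ (𝓕 : Set (Set Y)) := by
  constructor
  · intro hf 𝓗 hopen hcover
    obtain ⟨𝓕, h𝓕, U, hU, hsub⟩ := exists_finset_cover_mem_of_forall_ultrafilter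
      (l := comap Subtype.val (𝓝 x)) (fun 𝔘 h𝔘 => hf 𝔘 (tendsto_iff_comap.mpr h𝔘)) hopen hcover
    exact ⟨𝓕, h𝓕, U, hU, image_subset_iff.mpr hsub⟩
  · intro h 𝔘 h𝔘
    refine 𝔘.exists_tendsto_of_forall_cover fun 𝓗 hopen hcover => ?_
    obtain ⟨𝓕, h𝓕, U, hU, hsub⟩ := h 𝓗 hopen hcover
    exact ⟨𝓕, h𝓕, mem_of_superset (h𝔘 hU) (image_subset_iff.mp hsub)⟩
end

section
/- Let X be a topological space, Y a T1 regular topological space, A a dense subset of X, and f : A → Y a densely defined function that is subcontinuous at every point of X. Then for every x ∈ X the set {y ∈ Y : (x,y) ∈ closure {(a, f a) : a ∈ A}} is nonempty and compact. -/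
open Filter Set Topology

section

variable {X Y : Type*} [TopologicalSpace X] [TopologicalSpace Y]

theorem mem_dGraphCl_iff_neBot {A : Set X} {f : A → Y} {x : X} {y : Y} :
    y ∈ dGraphCl A f x ↔ (comap (Subtype.val : A → X) (𝓝 x) ⊓ comap f (𝓝 y)).NeBot := by
  have hrange : {p : X × Y | ∃ a : A, p = ((a : X), f a)} =
      range fun a : A => ((a : X), f a) := by
    ext p
    simp [eq_comm]
  have hcomap : comap (fun a : A => ((a : X), f a)) (𝓝 (x, y)) =
      comap (Subtype.val : A → X) (𝓝 x) ⊓ comap f (𝓝 y) := by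
    rw [nhds_prod_eq, Filter.prod_eq_inf, comap_inf, comap_comap, comap_comap]
    rfl
  change (x, y) ∈ closure _ ↔ _
  rw [hrange, ← hcomap, comap_neBot_iff_frequently, mem_closure_iff_frequently]

theorem mem_dGraphCl_of_tendsto {A : Set X} {f : A → Y} {x : X} {y : Y} {l : Filter A} [l.NeBot]
    (hx : Tendsto (Subtype.val : A → X) l (𝓝 x)) (hy : Tendsto f l (𝓝 y)) :
    y ∈ dGraphCl A f x :=
  mem_dGraphCl_iff_neBot.2 <|
    neBot_of_le (le_inf (tendsto_iff_comap.1 hx) (tendsto_iff_comap.1 hy))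

theorem DSubcontinuousAt.dGraphCl_nonempty {A : Set X} {f : A → Y} {x : X}
    (hf : DSubcontinuousAt A f x) (hx : x ∈ closure A) : (dGraphCl A f x).Nonempty := by
  have : (comap (Subtype.val : A → X) (𝓝 x)).NeBot := mem_closure_iff_comap_neBot.1 hx
  have hU := tendsto_iff_comap.2 (Ultrafilter.of_le (comap (Subtype.val : A → X) (𝓝 x)))
  obtain ⟨y, hy⟩ := hf _ hU
  exact ⟨y, mem_dGraphCl_of_tendsto hU hy⟩

theorem DSubcontinuousAt.isCompact_dGraphCl [RegularSpace Y] {A : Set X} {f : A → Y} {x : X}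
    (hf : DSubcontinuousAt A f x) : IsCompact (dGraphCl A f x) := by
  rw [isCompact_iff_ultrafilter_le_nhds']
  intro W hW
  -- `Filter.bind W 𝓝` consists of the sets whose interior belongs to `W`.
  have hne : (comap (Subtype.val : A → X) (𝓝 x) ⊓
      comap f (Filter.bind (W : Filter Y) 𝓝)).NeBot := by
    rw [neBot_inf_comap_iff_map, inf_neBot_iff]
    intro s hs t ht
    obtain ⟨y, hyK, hyt⟩ := W.nonempty_of_mem (inter_mem hW (mem_bind'.1 ht))
    exact inf_neBot_iff.1 (neBot_inf_comap_iff_map.1 (mem_dGraphCl_iff_neBot.1 hyK)) hs hyt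
  obtain ⟨U, hU⟩ := Ultrafilter.exists_le
    (comap (Subtype.val : A → X) (𝓝 x) ⊓ comap f (Filter.bind (W : Filter Y) 𝓝))
  have hUx := tendsto_iff_comap.2 (hU.trans inf_le_left)
  have hUW := tendsto_iff_comap.2 (hU.trans inf_le_right)
  obtain ⟨y, hy⟩ := hf U hUx
  refine ⟨y, mem_dGraphCl_of_tendsto hUx hy, (closed_nhds_basis y).ge_iff.2 ?_⟩
  rintro C ⟨hC, hCc⟩
  by_contra hCW
  have hCb : Cᶜ ∈ Filter.bind (W : Filter Y) 𝓝 :=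
    mem_bind'.2 (mem_of_superset (Ultrafilter.compl_mem_iff_notMem.2 hCW)
      fun z hz => hCc.isOpen_compl.mem_nhds hz)
  obtain ⟨a, ha, ha'⟩ := U.nonempty_of_mem (inter_mem (hy hC) (hUW hCb))
  exact ha' ha

end

variable {X Y : Type*} [TopologicalSpace X] [TopologicalSpace Y]
variable [T1Space Y] [RegularSpace Y]

theorem stmt7 (A : Set X) (hA : Dense A) (f : A → Y)
    (hf : ∀ x, DSubcontinuousAt A f x) :
    ∀ x, (dGraphCl A f x).Nonempty ∧ IsCompact (dGraphCl A f x) := by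
  exact fun x => ⟨(hf x).dGraphCl_nonempty (hA x), (hf x).isCompact_dGraphCl⟩
end

section
/- Let X be a topological space, Y a T1 regular topological space, A a dense subset of X, and f : A → Y a densely defined function that is subcontinuous at every point of X. Then the closure-of-graph map of f, i.e. the set-valued map x ↦ {y ∈ Y : (x,y) ∈ closure {(a, f a) : a ∈ A}}, is upper semicontinuous at every point of X. -/
open Filter Set Topology

/-- In a regular space, if every ultrafilter finer than `l` converges to a point of which `V` is a
neighborhood, then some member of `l` has its closure inside `V`. -/
theorem exists_mem_closure_subset_of_forall_ultrafilter {Z : Type*} [TopologicalSpace Z]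
    [RegularSpace Z] {l : Filter Z} {V : Set Z}
    (h : ∀ 𝒲 : Ultrafilter Z, (𝒲 : Filter Z) ≤ l → ∃ z, (𝒲 : Filter Z) ≤ 𝓝 z ∧ V ∈ 𝓝 z) :
    ∃ s ∈ l, closure s ⊆ V := by
  rw [← mem_lift'_sets (monotone_closure Z), Filter.mem_iff_ultrafilter]
  intro 𝒱 h𝒱
  let H : Filter Z :=
    { sets := {s | interior s ∈ 𝒱}
      univ_sets := by
        rw [mem_ofPred_eq, interior_univ]
        exact univ_mem (f := (𝒱 : Filter Z))
      sets_of_superset := fun hs hst => mem_of_superset hs (interior_mono hst)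
      inter_sets := fun hs ht => by
        rw [mem_ofPred_eq, interior_inter]
        exact inter_mem (f := (𝒱 : Filter Z)) hs ht }
  have hne : (l ⊓ H).NeBot := by
    rw [Filter.inf_neBot_iff]
    intro s hs t ht
    have hcl : closure s ∈ 𝒱 := h𝒱 (mem_lift' hs)
    obtain ⟨z, hzs, hzt⟩ := 𝒱.nonempty_of_mem (inter_mem hcl ht)
    obtain ⟨w, hwt, hws⟩ := mem_closure_iff.1 hzs _ isOpen_interior hzt
    exact ⟨w, hws, interior_subset hwt⟩
  obtain ⟨z, hz, hV⟩ := h (Ultrafilter.of (l ⊓ H)) ((Ultrafilter.of_le _).trans inf_le_left)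
  obtain ⟨C, hC, hCc, hCV⟩ := exists_mem_nhds_isClosed_subset hV
  refine mem_of_superset (x := C) ?_ hCV
  by_contra hn
  have hmem : Cᶜ ∈ H := by
    change interior Cᶜ ∈ 𝒱
    rw [hCc.isOpen_compl.interior_eq]
    exact Ultrafilter.compl_mem_iff_notMem.2 hn
  exact Ultrafilter.compl_mem_iff_notMem.1
    ((Ultrafilter.of_le (l ⊓ H)).trans inf_le_right hmem) (hz hC)

/-- The values of the closure-of-graph map are the cluster points of `f` along the traces on `A`
of the neighborhoods of `x`. -/
theorem mem_dGraphCl_iff {X Y : Type*} [TopologicalSpace X] [TopologicalSpace Y] {A : Set X}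
    {f : A → Y} {x : X} {y : Y} :
    y ∈ dGraphCl A f x ↔ MapClusterPt y (comap Subtype.val (𝓝 x)) f := by
  simp only [dGraphCl, mem_ofPred_eq, mem_closure_iff_nhds, mapClusterPt_iff_frequently,
    frequently_iff]
  constructor
  · rintro h s hs U ⟨t, ht, htU⟩
    obtain ⟨_, hp, a, rfl⟩ := h _ (prod_mem_nhds ht hs)
    exact ⟨a, htU hp.1, hp.2⟩
  · intro h t ht
    obtain ⟨u, hu, v, hv, huv⟩ := mem_nhds_prod_iff.1 ht
    obtain ⟨a, hau, hav⟩ := h v hv (preimage_mem_comap hu)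
    exact ⟨((a : X), f a), huv (mk_mem_prod hau hav), a, rfl⟩

variable {X Y : Type*} [TopologicalSpace X] [TopologicalSpace Y]
variable [T1Space Y] [RegularSpace Y]

theorem stmt8 (A : Set X) (hA : Dense A) (f : A → Y)
    (hf : ∀ x, DSubcontinuousAt A f x) :
    ∀ x, UscoAt (dGraphCl A f) x := by
  intro x V hV hxV
  obtain ⟨s, hs, hsV⟩ : ∃ s ∈ map f (comap Subtype.val (𝓝 x)), closure s ⊆ V := by
    refine exists_mem_closure_subset_of_forall_ultrafilter fun 𝒲 h𝒲 => ?_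
    obtain ⟨𝔘, h𝔘, rfl⟩ : ∃ 𝔘 : Ultrafilter A,
        (𝔘 : Filter A) ≤ comap Subtype.val (𝓝 x) ∧ 𝔘.map f = 𝒲 := by
      have hne : (comap Subtype.val (𝓝 x) ⊓ comap f 𝒲).NeBot := by
        rw [← map_neBot_iff f, Filter.push_pull, inf_eq_right.2 h𝒲]
        exact 𝒲.neBot
      exact ⟨Ultrafilter.of _, (Ultrafilter.of_le _).trans inf_le_left,
        Ultrafilter.eq_of_le (tendsto_iff_comap.2 ((Ultrafilter.of_le _).trans inf_le_right))⟩
    obtain ⟨y, hy⟩ := hf x 𝔘 (tendsto_iff_comap.2 h𝔘)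
    exact ⟨y, hy, hV.mem_nhds (hxV (mem_dGraphCl_iff.2 (hy.mapClusterPt.mono h𝔘)))⟩
  obtain ⟨U, hU, hUs⟩ := mem_comap.1 (mem_map.1 hs)
  refine ⟨interior U, interior_mem_nhds.2 hU, fun u hu y hy => hsV ?_⟩
  rw [mem_dGraphCl_iff] at hy
  have hsu : s ∈ map f (comap Subtype.val (𝓝 u)) :=
    mem_comap.2 ⟨U, mem_interior_iff_mem_nhds.1 hu, hUs⟩
  exact mem_closure_iff_clusterPt.2 (hy.clusterPt.mono (le_principal_iff.2 hsu))
end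

section
/- Let X be a Baire topological space and F : X → Set ℝ a usco map. Define f : X → ℝ by f x = inf (F x). Then f is lower semicontinuous, its set C(f) of points of continuity is a dense Gδ subset of X, and the set-valued map G defined by G x = {y : (x,y) ∈ closure {(a, f a) : a ∈ C(f)}} is a minimal usco map with G x ⊆ F x for every x ∈ X. -/
open Filter Set Topology

section Usco

variable {X Y : Type*} [TopologicalSpace X] [TopologicalSpace Y]

/-- The graph of a usco map into a Hausdorff space is closed. -/
theorem IsUsco.isClosed_graph [T2Space Y] {F : X → Set Y} (hF : IsUsco F) :
    IsClosed {p : X × Y | p.2 ∈ F p.1} := by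
  rw [← isOpen_compl_iff, isOpen_iff_mem_nhds]
  rintro ⟨x, y⟩ hxy
  have hdisj : Disjoint (F x) {y} := Set.disjoint_singleton_right.2 hxy
  obtain ⟨V, W, hV, hW, hFV, hyW, hVW⟩ :=
    SeparatedNhds.of_isCompact_isCompact (hF.2.1 x) isCompact_singleton hdisj
  obtain ⟨U, hU, hUV⟩ := hF.2.2 x V hV hFV
  filter_upwards [prod_mem_nhds hU (hW.mem_nhds (Set.singleton_subset_iff.1 hyW))]
    with p hp hpF
  exact Set.disjoint_left.1 hVW (hUV p.1 hp.1 hpF) hp.2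

/-- A map with closed graph that is contained in a usco map and has nonempty values on a dense
set is usco. -/
theorem IsUsco.of_isClosed_graph {F G : X → Set Y} (hF : IsUsco F)
    (hG : IsClosed {p : X × Y | p.2 ∈ G p.1}) (hGF : ∀ x, G x ⊆ F x) {C : Set X}
    (hC : Dense C) (hne : ∀ x ∈ C, (G x).Nonempty) : IsUsco G := by
  have husc : ∀ x, UscoAt G x := by
    intro x V hV hGV
    obtain ⟨U, W, hU, hW, hxU, hFW, hUW⟩ :=
      generalized_tube_lemma (isCompact_singleton (x := x)) ((hF.2.1 x).diff hV)
        hG.isOpen_compl (by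
          rintro ⟨a, y⟩ ⟨rfl, hy⟩ hya
          exact hy.2 (hGV hya))
    obtain ⟨U', hU', hFU'⟩ := hF.2.2 x (V ∪ W) (hV.union hW) fun y hy ↦ by
      by_cases hyV : y ∈ V
      · exact Or.inl hyV
      · exact Or.inr (hFW ⟨hy, hyV⟩)
    refine ⟨U ∩ U', inter_mem (hU.mem_nhds (Set.singleton_subset_iff.1 hxU)) hU', ?_⟩
    intro u hu y hy
    refine (hFU' u hu.2 (hGF u hy)).resolve_right fun hyW ↦ ?_
    exact hUW (Set.mk_mem_prod hu.1 hyW) hy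
  refine ⟨fun x ↦ ?_, fun x ↦ ?_, husc⟩
  · by_contra hx
    obtain ⟨U, hU, hUG⟩ :=
      husc x ∅ isOpen_empty (Set.not_nonempty_iff_eq_empty.1 hx).subset
    obtain ⟨a, haU, haC⟩ := mem_closure_iff_nhds.1 (hC x) U hU
    obtain ⟨y, hy⟩ := hne a haC
    exact hUG a haU hy
  · exact (hF.2.1 x).of_isClosed_subset
      (hG.preimage (Continuous.prodMk_right x)) (hGF x)

/-- The infimum selection of a real usco map is lower semicontinuous. -/
theorem IsUsco.lowerSemicontinuous_sInf {F : X → Set ℝ} (hF : IsUsco F) :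
    LowerSemicontinuous fun x ↦ sInf (F x) := by
  intro x c hc
  obtain ⟨U, hU, hUF⟩ := hF.2.2 x (Set.Ioi c) isOpen_Ioi fun y hy ↦
    hc.trans_le (csInf_le (hF.2.1 x).bddBelow hy)
  filter_upwards [hU] with u hu
  exact hUF u hu ((hF.2.1 u).sInf_mem (hF.1 u))

/-- A real lower semicontinuous function on a Baire space is continuous on a dense set. -/
theorem LowerSemicontinuous.dense_continuousAt [BaireSpace X] {f : X → ℝ}
    (hf : LowerSemicontinuous f) : Dense {x | ContinuousAt f x} := by
  have hcl : ∀ q : ℚ, IsClosed (f ⁻¹' Set.Iic (q : ℝ)) := fun q ↦ hf.isClosed_preimage q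
  have hd : Dense (⋂ q : ℚ, (frontier (f ⁻¹' Set.Iic (q : ℝ)))ᶜ) :=
    dense_iInter_of_isOpen (fun q ↦ isClosed_frontier.isOpen_compl)
      fun q ↦ interior_eq_empty_iff_dense_compl.1 (interior_frontier (hcl q))
  refine hd.mono fun x hx ↦ ?_
  refine continuousAt_iff_lower_upperSemicontinuousAt.2 ⟨hf x, fun r hr ↦ ?_⟩
  obtain ⟨q, hxq, hqr⟩ := exists_rat_btwn hr
  have hxint : x ∈ interior (f ⁻¹' Set.Iic (q : ℝ)) := by
    by_contra h
    refine Set.mem_iInter.1 hx q ?_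
    rw [(hcl q).frontier_eq]
    exact ⟨hxq.le, h⟩
  filter_upwards [mem_interior_iff_mem_nhds.1 hxint] with u hu
  exact lt_of_le_of_lt hu hqr

/-- At a continuity point of `f`, the closure of the graph of `f` restricted to any set has no
point other than the value of `f`. -/
theorem ContinuousAt.eq_of_mem_closure_graphOn [T2Space Y] {f : X → Y} {C : Set X} {x : X} {y : Y}
    (hf : ContinuousAt f x) (h : (x, y) ∈ closure {p : X × Y | p.1 ∈ C ∧ p.2 = f p.1}) :
    y = f x := by
  have hc : ContinuousAt (fun p : X × Y ↦ (p.2, f p.1)) (x, y) :=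
    continuousAt_snd.prodMk (ContinuousAt.comp (f := Prod.fst) hf continuousAt_fst)
  have := hc.continuousWithinAt.mem_closure h (t := Set.diagonal Y) fun p hp ↦ hp.2
  rwa [isClosed_diagonal.closure_eq] at this

end Usco

variable {X : Type*} [TopologicalSpace X] [BaireSpace X]

theorem stmt10 (F : X → Set ℝ) (hF : IsUsco F) (f : X → ℝ) (hf : ∀ x, f x = sInf (F x))
    (C : Set X) (hC : C = {x | ContinuousAt f x}) (G : X → Set ℝ)
    (hG : ∀ x, G x = {y | (x, y) ∈ closure {p : X × ℝ | p.1 ∈ C ∧ p.2 = f p.1}}) :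
    LowerSemicontinuous f ∧ IsGδ C ∧ Dense C ∧ IsMinimalUsco G ∧ ∀ x, G x ⊆ F x := by
  obtain rfl : f = fun x ↦ sInf (F x) := funext hf
  obtain rfl : G = _ := funext hG
  subst hC
  set f : X → ℝ := fun x ↦ sInf (F x)
  have hlsc : LowerSemicontinuous f := hF.lowerSemicontinuous_sInf
  have hdense : Dense {x | ContinuousAt f x} := hlsc.dense_continuousAt
  have hGF : closure {p : X × ℝ | p.1 ∈ {x | ContinuousAt f x} ∧ p.2 = f p.1} ⊆
      {p | p.2 ∈ F p.1} := by
    refine closure_minimal ?_ hF.isClosed_graph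
    rintro ⟨a, y⟩ ⟨-, hy⟩
    obtain rfl : y = f a := hy
    exact (hF.2.1 a).sInf_mem (hF.1 a)
  refine ⟨hlsc, IsGδ.setOfPred_continuousAt f, hdense, ⟨?_, fun H hH hHG ↦ ?_⟩, fun x y hy ↦ hGF hy⟩
  · exact hF.of_isClosed_graph isClosed_closure (fun x y hy ↦ hGF hy) hdense
      fun x hx ↦ ⟨f x, subset_closure ⟨hx, rfl⟩⟩
  · refine funext fun x ↦ (hHG x).antisymm fun y hy ↦ ?_
    refine closure_minimal (t := {p : X × ℝ | p.2 ∈ H p.1}) ?_ hH.isClosed_graph hy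
    rintro ⟨a, w⟩ ⟨ha, hw⟩
    obtain rfl : w = f a := hw
    obtain ⟨z, hz⟩ := hH.1 a
    have hza : z = f a := ContinuousAt.eq_of_mem_closure_graphOn ha (hHG a hz)
    exact hza ▸ hz
end

section
/- Let X = Y = ℝ with the usual topology and let f : ℝ → ℝ be defined by f x = 0 for x ≤ 0 and f x = 1/x for x > 0. Then the closed convex hull of {y : (x,y) ∈ closure of the graph of f} equals {f x} for every x ∈ ℝ, while ⋂ { closed convex hull of f '' V : V an open neighborhood of 0 } = [0, ∞); moreover f is not subcontinuous at 0. -/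
open Filter Set Topology

/-- If the graph of `f` is closed, then `graphCl f` is single-valued. -/
theorem graphCl_eq_singleton {X Y : Type*} [TopologicalSpace X] [TopologicalSpace Y] {f : X → Y}
    (hf : IsClosed {p : X × Y | p.2 = f p.1}) (x : X) : graphCl f x = {f x} := by
  ext y
  rw [graphCl, hf.closure_eq]
  rfl

/-- A function which tends to infinity along a nontrivial filter finer than `𝓝 x` is not
subcontinuous at `x`. -/
theorem not_subcontinuousAt_of_tendsto_atTop {X : Type*} [TopologicalSpace X] {f : X → ℝ} {x : X}
    {l : Filter X} [l.NeBot] (hl : l ≤ 𝓝 x) (hf : Tendsto f l atTop) :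
    ¬ SubcontinuousAt f x := by
  intro h
  obtain ⟨y, hy⟩ := h (Ultrafilter.of l) ((Ultrafilter.of_le l).trans hl)
  exact not_tendsto_nhds_of_tendsto_atTop (hf.mono_left (Ultrafilter.of_le l)) y hy

/-- The graph of the function equal to `0` on `(-∞, 0]` and to `1 / x` on `(0, ∞)` is closed. -/
theorem isClosed_graph_of_eq_one_div {f : ℝ → ℝ} (h1 : ∀ x ≤ (0 : ℝ), f x = 0)
    (h2 : ∀ x > (0 : ℝ), f x = 1 / x) : IsClosed {p : ℝ × ℝ | p.2 = f p.1} := by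
  have hgraph : {p : ℝ × ℝ | p.2 = f p.1} =
      {p | p.1 ≤ 0 ∧ p.2 = 0} ∪ {p | 0 ≤ p.1 ∧ p.2 * p.1 = 1} := by
    ext ⟨x, y⟩
    rcases lt_trichotomy x 0 with hx | rfl | hx
    · simp [h1 x hx.le, hx.le, hx.not_ge]
    · simp [h1 0 le_rfl]
    · simp [h2 x hx, hx.le, hx.not_ge, ← eq_div_iff hx.ne']
  rw [hgraph]
  exact ((isClosed_le continuous_fst continuous_const).inter
      (isClosed_eq continuous_snd continuous_const)).union
    ((isClosed_le continuous_const continuous_fst).inter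
      (isClosed_eq (continuous_snd.mul continuous_fst) continuous_const))

theorem stmt13 (f : ℝ → ℝ) (h1 : ∀ x ≤ (0 : ℝ), f x = 0) (h2 : ∀ x > (0 : ℝ), f x = 1 / x) :
    (∀ x, closure (convexHull ℝ (graphCl f x)) = {f x}) ∧
    (⋂ V ∈ {V : Set ℝ | IsOpen V ∧ (0 : ℝ) ∈ V},
        closure (convexHull ℝ (f '' V))) = Ici (0 : ℝ) ∧
    ¬ SubcontinuousAt f 0 := by
  have htop : Tendsto f (𝓝[>] 0) atTop := by
    refine tendsto_inv_nhdsGT_zero.congr' ?_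
    filter_upwards [self_mem_nhdsWithin] with x hx
    rw [h2 x hx, one_div]
  refine ⟨fun x => ?_, ?_, not_subcontinuousAt_of_tendsto_atTop nhdsWithin_le_nhds htop⟩
  · simp [graphCl_eq_singleton (isClosed_graph_of_eq_one_div h1 h2)]
  · apply Subset.antisymm
    · refine (biInter_subset_of_mem (show univ ∈ {V : Set ℝ | IsOpen V ∧ (0 : ℝ) ∈ V} from
        ⟨isOpen_univ, mem_univ _⟩)).trans ?_
      refine closure_minimal (convexHull_min ?_ (convex_Ici 0)) isClosed_Ici
      rintro _ ⟨x, -, rfl⟩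
      rcases le_or_gt x 0 with hx | hx
      · exact (h1 x hx).ge
      · rw [h2 x hx]
        exact (one_div_pos.2 hx).le
    · refine fun y hy => mem_iInter₂.2 fun V hV => subset_closure ?_
      obtain ⟨x, hxV, hyx⟩ := (((hV.1.eventually_mem hV.2).filter_mono nhdsWithin_le_nhds).and
        (htop.eventually_ge_atTop y)).exists
      have h0 : (0 : ℝ) ∈ f '' V := ⟨0, hV.2, h1 0 le_rfl⟩
      exact (convex_convexHull ℝ (f '' V)).ordConnected.out (subset_convexHull ℝ _ h0)
        (subset_convexHull ℝ _ (mem_image_of_mem f hxV)) ⟨hy, hyx⟩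
end

section
/- Let X be a topological space, Y a topological space, and F : X → Set Y a usco map. Then every selection f of F (i.e. every function f : X → Y with f x ∈ F x for all x) is subcontinuous at every point of X. -/
open Filter Set Topology

variable {X Y : Type*} [TopologicalSpace X] [TopologicalSpace Y]

theorem stmt19 (F : X → Set Y) (hF : IsUsco F) (f : X → Y) (hf : ∀ x, f x ∈ F x) :
    ∀ x, SubcontinuousAt f x := by
  intro x 𝔘 h𝔘
  by_contra! h
  have hle : (𝔘.map f : Filter Y) ≤ 𝓝ˢ (F x) := by
    intro V hV
    obtain ⟨W, hW, hFW, hWV⟩ := mem_nhdsSet_iff_exists.1 hV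
    obtain ⟨U, hU, hUW⟩ := hF.2.2 x W hW hFW
    have hU𝔘 : U ∈ (𝔘 : Filter X) := h𝔘 hU
    exact mem_map.2 <| mem_of_superset hU𝔘 fun u hu => hWV (hUW u hu (hf u))
  have hdisj : Disjoint (𝓝ˢ (F x)) (𝔘.map f : Filter Y) := by
    refine (hF.2.1 x).disjoint_nhdsSet_left.2 fun y _ => ?_
    by_contra hy
    rw [disjoint_comm, disjoint_iff] at hy
    exact h y (Ultrafilter.le_of_inf_neBot (𝔘.map f) ⟨hy⟩)
  exact (𝔘.map f).neBot.ne (disjoint_self.1 (hdisj.mono_left hle))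
end
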